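/- arXiv:math/0304403 — 2 statements merged into one kernel-verified Lean document; each statement's English description precedes it below -/
import Mathlib

section
/- Fix integers 1 ≤ r ≤ n. Let P ∈ ℂ[x₁,…,x_r] be a symmetric polynomial such that P·Δ lies in the ideal generated by x₁^n, …, x_r^n. Then P lies in the ideal of ℂ[x₁,…,x_r] generated by the complete homogeneous symmetric polynomials h_{n−r+1}, …, h_n. -/
open Finset MvPolynomial

/-- The complete homogeneous symmetric polynomial of degree `k` in the variables
`x₁, …, x_r`: the sum of all monomials of total degree `k`. -/
noncomputable def hsymm (r k : ℕ) : MvPolynomial (Fin r) ℂ :=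
  ∑ d ∈ (Fintype.piFinset fun _ : Fin r => Finset.range (k + 1)).filter
      (fun d => ∑ i, d i = k),
    ∏ i, X i ^ d i

/-- The Vandermonde determinant `Δ = ∏_{1 ≤ i < j ≤ r} (xᵢ - xⱼ)`. -/
noncomputable def vander (r : ℕ) : MvPolynomial (Fin r) ℂ :=
  ∏ p ∈ Finset.univ.filter (fun p : Fin r × Fin r => p.1 < p.2), (X p.1 - X p.2)

namespace ESaux

noncomputable def HH (r : ℕ) : PowerSeries (MvPolynomial (Fin r) ℂ) := PowerSeries.mk (hsymm r)

noncomputable def geo (r : ℕ) (i : Fin r) : PowerSeries (MvPolynomial (Fin r) ℂ) :=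
  PowerSeries.mk fun k => (X i : MvPolynomial (Fin r) ℂ) ^ k

noncomputable def lin (r : ℕ) (i : Fin r) : Polynomial (MvPolynomial (Fin r) ℂ) :=
  1 - Polynomial.C (X i) * Polynomial.X

lemma geo_mul_lin (r : ℕ) (i : Fin r) : geo r i * (lin r i : PowerSeries _) = 1 := by
  ext1 k
  have : geo r i * (lin r i : PowerSeries _)
      = geo r i - PowerSeries.C (X i) * (geo r i * PowerSeries.X) := by
    simp only [lin, Polynomial.coe_sub, Polynomial.coe_one, Polynomial.coe_mul,
      Polynomial.coe_C, Polynomial.coe_X]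
    ring
  rw [this]
  cases k with
  | zero => simp [geo]
  | succ k =>
    rw [map_sub, PowerSeries.coeff_C_mul, PowerSeries.coeff_succ_mul_X]
    simp [geo, PowerSeries.coeff_one, pow_succ']

lemma HH_eq (r : ℕ) : HH r = ∏ i, geo r i := by
  ext1 k
  rw [PowerSeries.coeff_prod, HH, PowerSeries.coeff_mk, _root_.hsymm]
  symm
  refine Finset.sum_bij (fun d _ => (d : Fin r → ℕ)) ?_ ?_ ?_ ?_
  · intro d hd
    rw [Finset.mem_finsuppAntidiag] at hd
    simp only [Finset.mem_filter, Fintype.mem_piFinset, Finset.mem_range]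
    refine ⟨fun i => ?_, hd.1⟩
    have := Finset.single_le_sum (f := fun i => d i) (fun i _ => Nat.zero_le _) (Finset.mem_univ i)
    have h2 := hd.1
    exact Nat.lt_succ_of_le (this.trans_eq h2)
  · intro a _ b _ h
    exact DFunLike.coe_injective h
  · intro b hb
    simp only [Finset.mem_filter] at hb
    refine ⟨Finsupp.equivFunOnFinite.symm b, ?_, ?_⟩
    · rw [Finset.mem_finsuppAntidiag]
      exact ⟨by simpa using hb.2, by simp⟩
    · simp
  · intro d _
    simp [geo]

noncomputable def EE (r : ℕ) (i : Fin r) : Polynomial (MvPolynomial (Fin r) ℂ) :=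
  ∏ j ∈ Finset.univ.erase i, lin r j

lemma lin_natDegree (r : ℕ) (i : Fin r) : (lin r i).natDegree ≤ 1 := by
  unfold lin
  compute_degree

lemma EE_natDegree (r : ℕ) (i : Fin r) : (EE r i).natDegree < r := by
  have h1 : (EE r i).natDegree ≤ r - 1 := by
    refine (Polynomial.natDegree_prod_le _ _).trans ?_
    refine (Finset.sum_le_card_nsmul _ _ 1 (fun j _ => lin_natDegree r j)).trans ?_
    simp
  have := i.2
  omega

lemma HH_mul_prod (r : ℕ) : HH r * ((∏ j, lin r j : Polynomial _) : PowerSeries _) = 1 := by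
  rw [HH_eq, ← Polynomial.coeToPowerSeries.ringHom_apply, map_prod, ← Finset.prod_mul_distrib]
  exact Finset.prod_eq_one fun i _ => geo_mul_lin r i

lemma HH_mul_EE (r : ℕ) (i : Fin r) : HH r * (EE r i : PowerSeries _) = geo r i := by
  have h := HH_mul_prod r
  rw [← Finset.mul_prod_erase _ _ (Finset.mem_univ i), Polynomial.coe_mul] at h
  calc _ = (geo r i * (lin r i : PowerSeries _)) * (HH r * (EE r i : PowerSeries _)) := by
        rw [geo_mul_lin, one_mul]
    _ = geo r i * (HH r * ((lin r i : PowerSeries _) * (EE r i : PowerSeries _))) := by ring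
    _ = _ := by
      rw [EE, h, mul_one]

lemma coeff_mul_poly {R : Type*} [CommRing R] (H : PowerSeries R) (p : Polynomial R) (r : ℕ)
    (hp : p.natDegree < r) (m : ℕ) :
    PowerSeries.coeff m (H * (p : PowerSeries R)) =
      ∑ k ∈ Finset.range r, p.coeff k * (if k ≤ m then PowerSeries.coeff (m - k) H else 0) := by
  rw [mul_comm, PowerSeries.coeff_mul, Finset.Nat.sum_antidiagonal_eq_sum_range_succ_mk]
  simp only [Polynomial.coeff_coe]
  have e1 : ∑ k ∈ Finset.range m.succ, p.coeff k * PowerSeries.coeff (m - k) H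
      = ∑ k ∈ Finset.range (m + 1 + r),
        p.coeff k * (if k ≤ m then PowerSeries.coeff (m - k) H else 0) := by
    rw [← Finset.sum_subset (Finset.range_mono (Nat.le_add_right (m+1) r))]
    · refine Finset.sum_congr rfl fun k hk => ?_
      rw [Finset.mem_range] at hk
      rw [if_pos (by omega)]
    · intro k _ hk
      rw [Finset.mem_range] at hk
      rw [if_neg (by omega), mul_zero]
  rw [e1]
  symm
  refine Finset.sum_subset (Finset.range_mono (Nat.le_add_left r (m+1))) ?_
  intro k _ hk
  rw [Finset.mem_range] at hk
  rw [Polynomial.coeff_eq_zero_of_natDegree_lt (by omega), zero_mul]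

noncomputable def TT (r : ℕ) (m : Fin r → ℕ) : Matrix (Fin r) (Fin r) (MvPolynomial (Fin r) ℂ) :=
  Matrix.of fun k j => if (k : ℕ) ≤ m j then hsymm r (m j - k) else 0

noncomputable def NN (r : ℕ) : Matrix (Fin r) (Fin r) (MvPolynomial (Fin r) ℂ) :=
  Matrix.of fun i k => (EE r i).coeff k

noncomputable def WW (r : ℕ) (m : Fin r → ℕ) : Matrix (Fin r) (Fin r) (MvPolynomial (Fin r) ℂ) :=
  Matrix.of fun i j => X i ^ m j

lemma WW_eq (r : ℕ) (m : Fin r → ℕ) : WW r m = NN r * TT r m := by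
  ext1 i j
  have h := coeff_mul_poly (HH r) (EE r i) r (EE_natDegree r i) (m j)
  rw [HH_mul_EE, geo, PowerSeries.coeff_mk, Finset.sum_range] at h
  simp only [WW, Matrix.of_apply, Matrix.mul_apply, NN, TT, h, HH, PowerSeries.coeff_mk]

lemma hsymm_zero (r : ℕ) : hsymm r 0 = 1 := by
  have h := congrArg (PowerSeries.coeff 0) (HH_eq r)
  simpa [HH, geo] using h

lemma det_TT_val (r : ℕ) : (TT r (fun j => j)).det = 1 := by
  rw [Matrix.det_of_upperTriangular]
  · simp [TT, hsymm_zero]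
  · intro i j hij
    simp only [id] at hij
    simp only [TT, Matrix.of_apply]
    rw [if_neg]
    simpa using hij

lemma det_WW (r : ℕ) (m : Fin r → ℕ) :
    (WW r m).det = (WW r (fun j => j)).det * (TT r m).det := by
  rw [WW_eq, WW_eq r (fun j => j), Matrix.det_mul, Matrix.det_mul, det_TT_val, mul_one]

lemma hsymm_mem (n r : ℕ) (hr : 1 ≤ r) (hrn : r ≤ n) (q : ℕ) (hq : n - r + 1 ≤ q) :
    hsymm r q ∈ Ideal.span ((fun k => hsymm r k) '' Set.Icc (n - r + 1) n) := by
  induction q using Nat.strong_induction_on with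
  | _ q ih =>
    by_cases hqn : q ≤ n
    · exact Ideal.subset_span ⟨q, ⟨hq, hqn⟩, rfl⟩
    · have hd : (∏ j, lin r j).natDegree < r + 1 := by
        refine Nat.lt_succ_of_le ((Polynomial.natDegree_prod_le _ _).trans ?_)
        refine (Finset.sum_le_card_nsmul _ _ 1 (fun j _ => lin_natDegree r j)).trans ?_
        simp
      have h := coeff_mul_poly (HH r) (∏ j, lin r j) (r + 1) hd q
      rw [HH_mul_prod, PowerSeries.coeff_one, if_neg (by omega), Finset.sum_range_succ'] at h
      have h0 : (∏ j, lin r j).coeff 0 = 1 := by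
        rw [Polynomial.coeff_zero_prod]
        simp [lin]
      rw [h0, one_mul, if_pos (Nat.zero_le _), Nat.sub_zero, HH, PowerSeries.coeff_mk] at h
      rw [eq_neg_of_add_eq_zero_right h.symm]
      refine neg_mem (sum_mem fun k hk => Ideal.mul_mem_left _ _ ?_)
      rw [Finset.mem_range] at hk
      rw [if_pos (by omega), PowerSeries.coeff_mk]
      exact ih _ (by omega) (by omega)

lemma det_TT_mem (n r : ℕ) (hr : 1 ≤ r) (hrn : r ≤ n) (m : Fin r → ℕ) (j : Fin r) (hj : n ≤ m j) :
    (TT r m).det ∈ Ideal.span ((fun k => hsymm r k) '' Set.Icc (n - r + 1) n) := by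
  rw [← Ideal.Quotient.eq_zero_iff_mem, RingHom.map_det]
  refine Matrix.det_eq_zero_of_column_eq_zero j fun k => ?_
  rw [RingHom.mapMatrix_apply, Matrix.map_apply, Ideal.Quotient.eq_zero_iff_mem]
  have := k.2
  simp only [TT, Matrix.of_apply]
  rw [if_pos (by omega)]
  exact hsymm_mem n r hr hrn _ (by omega)

/-- antisymmetrization -/
noncomputable def AA (r : ℕ) : MvPolynomial (Fin r) ℂ →ₗ[ℂ] MvPolynomial (Fin r) ℂ :=
  ∑ σ : Equiv.Perm (Fin r), ((Equiv.Perm.sign σ : ℤ) : ℂ) • (rename σ).toLinearMap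

lemma AA_apply (r : ℕ) (G : MvPolynomial (Fin r) ℂ) :
    AA r G = ∑ σ : Equiv.Perm (Fin r), ((Equiv.Perm.sign σ : ℤ) : ℂ) • rename σ G := by
  simp [AA]

lemma AA_monomial (r : ℕ) (m : Fin r →₀ ℕ) : AA r (monomial m 1) = (WW r m).det := by
  rw [AA_apply, Matrix.det_apply']
  refine Finset.sum_congr rfl fun σ _ => ?_
  rw [monomial_eq, Finsupp.prod_fintype _ _ (by simp)]
  simp [WW, smul_eq_C_mul]

lemma AA_mem (n r : ℕ) (hr : 1 ≤ r) (hrn : r ≤ n) (G : MvPolynomial (Fin r) ℂ)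
    (h : G ∈ Ideal.span (Set.range fun i : Fin r => (X i : MvPolynomial (Fin r) ℂ) ^ n)) :
    ∃ Q ∈ Ideal.span ((fun k => hsymm r k) '' Set.Icc (n - r + 1) n),
      AA r G = (WW r (fun j => j)).det * Q := by
  have hs : (Set.range fun i : Fin r => (X i : MvPolynomial (Fin r) ℂ) ^ n)
      = (fun s => monomial s (1 : ℂ)) '' (Set.range fun i : Fin r => Finsupp.single i n) := by
    rw [← Set.range_comp]
    congr 1
    ext1 i
    simp [X_pow_eq_monomial]
  rw [hs, mem_ideal_span_monomial_image] at h
  refine ⟨∑ m ∈ G.support, C (coeff m G) * (TT r m).det, ?_, ?_⟩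
  · refine sum_mem fun m hm => Ideal.mul_mem_left _ _ ?_
    obtain ⟨_, ⟨j, rfl⟩, hle⟩ := h m hm
    refine det_TT_mem n r hr hrn m j ?_
    simpa using hle j
  · conv_lhs => rw [G.as_sum]
    rw [map_sum, Finset.mul_sum]
    refine Finset.sum_congr rfl fun m _ => ?_
    have : monomial m (coeff m G) = coeff m G • monomial m (1 : ℂ) := by
      rw [smul_monomial, smul_eq_mul, mul_one]
    rw [this, map_smul, AA_monomial, det_WW, smul_eq_C_mul]
    ring

lemma rename_det (r : ℕ) (σ : Equiv.Perm (Fin r)) :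
    rename σ (WW r (fun j => j)).det
      = ((Equiv.Perm.sign σ : ℤ) : ℂ) • (WW r (fun j => j)).det := by
  have h := Matrix.det_permute σ (WW r (fun j => j))
  rw [AlgHom.map_det, smul_eq_C_mul]
  have e : (rename σ : MvPolynomial (Fin r) ℂ →ₐ[ℂ] _).mapMatrix (WW r (fun j => j))
      = (WW r (fun j => j)).submatrix σ id := by
    ext1 i j
    simp [WW]
  rw [e, h]
  simp

lemma AA_mul (r : ℕ) (P : MvPolynomial (Fin r) ℂ) (hP : P.IsSymmetric) :
    AA r (P * (WW r (fun j => j)).det)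
      = C (r.factorial : ℂ) * (P * (WW r (fun j => j)).det) := by
  rw [AA_apply]
  have : ∀ σ : Equiv.Perm (Fin r), ((Equiv.Perm.sign σ : ℤ) : ℂ) •
      rename σ (P * (WW r (fun j => j)).det) = P * (WW r (fun j => j)).det := by
    intro σ
    rw [map_mul, hP σ, rename_det, mul_smul_comm, smul_smul]
    rcases Int.units_eq_one_or (Equiv.Perm.sign σ) with h | h <;> simp [h]
  rw [Finset.sum_congr rfl fun σ _ => this σ]
  simp [Fintype.card_perm]

lemma det_val (r : ℕ) : ∃ k : ℕ, (WW r (fun j => j)).det = (-1) ^ k * vander r := by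
  have e : WW r (fun j => j) = Matrix.vandermonde X := by
    ext1 i j
    simp [WW]
  refine ⟨((Finset.univ.filter (fun p : Fin r × Fin r => p.1 < p.2))).card, ?_⟩
  rw [e, Matrix.det_vandermonde, vander, ← Finset.prod_const, ← Finset.prod_mul_distrib,
    Finset.prod_filter, Fintype.prod_prod_type]
  refine Finset.prod_congr rfl fun i _ => ?_
  rw [← Finset.prod_filter]
  refine Finset.prod_congr ?_ fun j _ => by ring
  ext j
  simp

lemma det_ne_zero (r : ℕ) : (WW r (fun j => j)).det ≠ 0 := by
  have e : WW r (fun j => j) = Matrix.vandermonde X := by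
    ext1 i j
    simp [WW]
  rw [e, Matrix.det_vandermonde_ne_zero_iff]
  exact X_injective

end ESaux

/-- Injectivity in Corollary 2.2 (Ellingsrud–Strømme): for `1 ≤ r ≤ n`, if a symmetric
polynomial `P ∈ ℂ[x₁,…,x_r]` is such that `P·Δ` lies in the ideal `⟨x₁ⁿ, …, x_rⁿ⟩`,
then `P` lies in the ideal generated by `h_{n-r+1}, …, h_n`. -/
theorem ES_injectivity (n r : ℕ) (hr : 1 ≤ r) (hrn : r ≤ n)
    (P : MvPolynomial (Fin r) ℂ) (hP : P.IsSymmetric)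
    (h : P * vander r ∈ Ideal.span (Set.range fun i : Fin r => (X i : MvPolynomial (Fin r) ℂ) ^ n)) :
    P ∈ Ideal.span ((fun k => hsymm r k) '' Set.Icc (n - r + 1) n) := by
  obtain ⟨k, hk⟩ := ESaux.det_val r
  have h1 : P * (ESaux.WW r (fun j => j)).det ∈
      Ideal.span (Set.range fun i : Fin r => (X i : MvPolynomial (Fin r) ℂ) ^ n) := by
    rw [hk, mul_left_comm]
    exact Ideal.mul_mem_left _ _ h
  obtain ⟨Q, hQ, e⟩ := ESaux.AA_mem n r hr hrn _ h1
  rw [ESaux.AA_mul r P hP, ← mul_assoc, mul_comm] at e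
  have e2 := mul_left_cancel₀ (ESaux.det_ne_zero r) e
  have e3 : P = C ((r.factorial : ℂ)⁻¹) * Q := by
    rw [← e2, ← mul_assoc, ← C_mul, inv_mul_cancel₀ (by exact_mod_cast r.factorial_ne_zero),
      C_1, one_mul]
  rw [e3]
  exact Ideal.mul_mem_left _ _ hQ
end

section
/- Fix integers 1 ≤ r ≤ n. Let P ∈ ℂ[x₁,…,x_r] be a symmetric polynomial, homogeneous of degree r(n−r). Let c₀ := ((−1)^{r(r−1)/2} / r!) times the coefficient of the monomial x₁^{n−1}·x₂^{n−1}⋯x_r^{n−1} in the polynomial P·Δ². Then P − c₀·(x₁x₂⋯x_r)^{n−r} lies in the ideal of ℂ[x₁,…,x_r] generated by the complete homogeneous symmetric polynomials h_{n−r+1}, …, h_n. -/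
open Finset MvPolynomial

/-- complete homogeneous polynomials of a list, by recursion -/
noncomputable def hl {R : Type*} [CommRing R] : List R → ℕ → R
  | [], 0 => 1
  | [], _ + 1 => 0
  | _ :: _, 0 => 1
  | a :: L, k + 1 => hl L (k + 1) + a * hl (a :: L) k

/-- the reversed list of the first `l` values -/
def kl {R : Type*} (x : ℕ → R) : ℕ → List R
  | 0 => []
  | l + 1 => x l :: kl x l

theorem hl_zero {R : Type*} [CommRing R] (L : List R) : hl L 0 = 1 := by
  cases L <;> simp [hl]

theorem hl_swap {R : Type*} [CommRing R] (t a : R) (L : List R) (k : ℕ) :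
    hl (t :: L) (k + 1) - hl (a :: L) (k + 1) = (t - a) * hl (t :: a :: L) k := by
  induction k with
  | zero => simp [hl, hl_zero]
  | succ k ih =>
    have e : ∀ (b : R) (M : List R) (j : ℕ), hl (b :: M) (j + 1) = hl M (j + 1) + b * hl (b :: M) j :=
      fun b M j => by rw [hl]
    rw [e t L (k + 1), e a L (k + 1), e t (a :: L) k]
    linear_combination t * ih

theorem newton_aux {R : Type*} [CommRing R] (x : ℕ → R) (t : R) (k m : ℕ) :
    t ^ k = ∑ l ∈ range m, (if l ≤ k then hl (kl x (l + 1)) (k - l) else 0) *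
        ∏ i ∈ range l, (t - x i)
      + (∏ i ∈ range m, (t - x i)) * (if m ≤ k then hl (t :: kl x m) (k - m) else 0) := by
  induction m with
  | zero =>
    simp only [range_zero, sum_empty, prod_empty, zero_add, Nat.zero_le, if_true, one_mul, kl,
      Nat.sub_zero]
    induction k with
    | zero => simp [hl]
    | succ k ih => rw [hl, ← ih, hl]; ring
  | succ m ih =>
    rw [ih, sum_range_succ, prod_range_succ]
    rcases lt_trichotomy m k with h | h | h
    · obtain ⟨j, rfl⟩ := Nat.exists_eq_add_of_lt h
      have e1 : m + j + 1 - m = j + 1 := by omega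
      have e2 : m + j + 1 - (m + 1) = j := by omega
      rw [if_pos h.le, if_pos h.le, if_pos (by omega), e1, e2]
      have := hl_swap t (x m) (kl x m) j
      simp only [kl]
      linear_combination (∏ i ∈ range m, (t - x i)) * this
    · subst h
      simp [hl_zero]
    · rw [if_neg (by omega), if_neg (by omega), if_neg (by omega)]
      simp

theorem newton {R : Type*} [CommRing R] (x : ℕ → R) (r i k : ℕ) (hi : i < r) :
    x i ^ k = ∑ l ∈ range r, (if l ≤ k then hl (kl x (l + 1)) (k - l) else 0) *
        ∏ j ∈ range l, (x i - x j) := by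
  rw [newton_aux x (x i) k r]
  have : ∏ j ∈ range r, (x i - x j) = 0 :=
    prod_eq_zero (mem_range.2 hi) (sub_self _)
  rw [this]; simp

theorem hl_mem {R : Type*} [CommRing R] (x : ℕ → R) (n r : ℕ) (hrn : r ≤ n) (I : Ideal R)
    (h : ∀ k, n - r + 1 ≤ k → k ≤ n → hl (kl x r) k ∈ I) :
    ∀ l, l ≤ r → ∀ k, n - l + 1 ≤ k → hl (kl x l) k ∈ I := by
  have h1 : ∀ d, d ≤ r → ∀ k, n - (r - d) + 1 ≤ k → k ≤ n → hl (kl x (r - d)) k ∈ I := by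
    intro d
    induction d with
    | zero => intro _ k; simpa using h k
    | succ d ih =>
      intro hd k hk hkn
      obtain ⟨k, rfl⟩ : ∃ k', k = k' + 1 := ⟨k - 1, by omega⟩
      have a := ih (by omega) (k + 1) (by omega) hkn
      have b := ih (by omega) k (by omega) (by omega)
      have e : r - d = (r - (d + 1)) + 1 := by omega
      rw [e, kl] at a b
      rw [hl] at a
      exact (Ideal.add_mem_iff_left I (I.mul_mem_left _ b)).1 a
  intro l
  induction l with
  | zero =>
    intro _ k hk
    obtain ⟨k, rfl⟩ : ∃ k', k = k' + 1 := ⟨k - 1, by omega⟩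
    simp [kl, hl]
  | succ l ih =>
    intro hl' k
    induction k with
    | zero => intro hk; omega
    | succ k ihk =>
      intro hk
      rcases Nat.lt_or_ge n (k + 1) with hn | hn
      · rw [kl, hl]
        exact I.add_mem (ih (by omega) _ (by omega)) (I.mul_mem_left _ (ihk (by omega)))
      · have := h1 (r - (l + 1)) (by omega) (k + 1)
        rw [show r - (r - (l + 1)) = l + 1 by omega] at this
        exact this hk hn

theorem hl_cons {R : Type*} [CommRing R] (a : R) (L : List R) (k : ℕ) :
    hl (a :: L) k = ∑ p ∈ antidiagonal k, a ^ p.1 * hl L p.2 := by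
  induction k with
  | zero => simp [hl_zero]
  | succ k ih =>
    rw [hl, ih, Finset.Nat.antidiagonal_succ, sum_cons, sum_map, mul_sum]
    simp [pow_succ']
    exact sum_congr rfl fun p _ => by ring

theorem hl_ofFn {R : Type*} [CommRing R] (l : ℕ) : ∀ (y : Fin l → R) (k : ℕ),
    hl (List.ofFn y) k = ∑ d ∈ Finset.Nat.antidiagonalTuple l k, ∏ i, y i ^ d i := by
  induction l with
  | zero => intro y k; cases k <;> simp [hl]
  | succ l ih =>
    intro y k
    rw [List.ofFn_succ, hl_cons]
    simp_rw [ih, mul_sum]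
    rw [sum_sigma']
    refine sum_bij' (fun p _ => Fin.cons p.1.1 p.2) (fun d _ => ⟨(d 0, ∑ i, Fin.tail d i), Fin.tail d⟩)
      ?_ ?_ ?_ ?_ ?_
    · rintro ⟨⟨a, b⟩, d⟩ h
      simp only [mem_sigma, HasAntidiagonal.mem_antidiagonal, Finset.Nat.mem_antidiagonalTuple] at h ⊢
      rw [Fin.sum_univ_succ]; simp [h.2, h.1]
    · intro d h
      simp only [mem_sigma, HasAntidiagonal.mem_antidiagonal, Finset.Nat.mem_antidiagonalTuple] at h ⊢
      rw [Fin.sum_univ_succ] at h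
      exact ⟨h, trivial⟩
    · rintro ⟨⟨a, b⟩, d⟩ h
      simp only [mem_sigma, HasAntidiagonal.mem_antidiagonal, Finset.Nat.mem_antidiagonalTuple] at h ⊢
      simp [h.2]
    · intro d h; simp
    · rintro ⟨⟨a, b⟩, d⟩ h
      rw [Fin.prod_univ_succ]; simp

theorem kl_eq_ofFn {R : Type*} (x : ℕ → R) (r : ℕ) :
    kl x r = List.ofFn (fun i : Fin r => x (r - 1 - i)) := by
  induction r with
  | zero => simp [kl]
  | succ r ih =>
    rw [kl, List.ofFn_succ, ih]
    simp
    ext i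
    congr 1; omega

/-- the reversed variables -/
noncomputable def xv (r : ℕ) (j : ℕ) : MvPolynomial (Fin r) ℂ :=
  if h : r - 1 - j < r then X ⟨r - 1 - j, h⟩ else 0

theorem xv_rev (r : ℕ) (i : Fin r) : xv r (r - 1 - i) = X i := by
  have : r - 1 - (r - 1 - (i : ℕ)) = i := by omega
  simp [xv, this]

theorem hsymm_eq (r k : ℕ) : hsymm r k = hl (kl (xv r) r) k := by
  rw [kl_eq_ofFn]
  simp_rw [xv_rev]
  rw [hl_ofFn, _root_.hsymm]
  refine sum_congr ?_ fun _ _ => rfl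
  ext d
  simp only [mem_filter, Fintype.mem_piFinset, mem_range, Finset.Nat.mem_antidiagonalTuple,
    and_iff_right_iff_imp]
  rintro rfl i
  exact Nat.lt_succ_of_le (single_le_sum (f := d) (fun _ _ => Nat.zero_le _) (mem_univ i))

/-- the alternant -/
noncomputable def alt (r : ℕ) (a : Fin r → ℕ) : MvPolynomial (Fin r) ℂ :=
  (Matrix.of fun i j : Fin r => (X i : MvPolynomial (Fin r) ℂ) ^ a j).det

noncomputable def vd (r : ℕ) : MvPolynomial (Fin r) ℂ :=
  (Matrix.vandermonde (X : Fin r → MvPolynomial (Fin r) ℂ)).det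

theorem vd_ne_zero (r : ℕ) : vd r ≠ 0 :=
  Matrix.det_vandermonde_ne_zero_iff.2 (MvPolynomial.X_injective)

/-- generalized Schur polynomial -/
noncomputable def gs (r : ℕ) (a : Fin r → ℕ) : MvPolynomial (Fin r) ℂ :=
  (Matrix.of fun l j : Fin r =>
    if (l : ℕ) ≤ a j then hl (kl (xv r) (l + 1)) (a j - l) else 0).det

theorem alt_eq (r : ℕ) (a : Fin r → ℕ) : alt r a = vd r * gs r a := by
  rw [vd, gs, Matrix.det_eval_matrixOfPolynomials_eq_det_vandermonde _
    (fun l : Fin r => ∏ j ∈ range l, (Polynomial.X - Polynomial.C (xv r j)))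
    (fun l => by
      rw [Polynomial.natDegree_prod_of_monic _ _ fun j _ => Polynomial.monic_X_sub_C _]; simp)
    (fun l => Polynomial.monic_prod_of_monic _ _ fun j _ => Polynomial.monic_X_sub_C _),
    ← Matrix.det_mul, alt]
  congr 1
  ext1 i j
  simp only [Matrix.of_apply, Matrix.mul_apply, Polynomial.eval_prod, Polynomial.eval_sub,
    Polynomial.eval_X, Polynomial.eval_C]
  have := newton (xv r) r (r - 1 - i) (a j) (by omega)
  rw [xv_rev] at this
  rw [this, ← Fin.sum_univ_eq_sum_range (fun l => (if l ≤ a j then hl (kl (xv r) (l + 1)) (a j - l) else 0) *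
        ∏ j ∈ range l, (X i - xv r j))]
  exact sum_congr rfl fun _ _ => mul_comm _ _

theorem gs_mem (n r : ℕ) (hrn : r ≤ n) (a : Fin r → ℕ) (j : Fin r) (hj : n ≤ a j) :
    gs r a ∈ Ideal.span ((fun k => hsymm r k) '' Set.Icc (n - r + 1) n) := by
  set I := Ideal.span ((fun k => hsymm r k) '' Set.Icc (n - r + 1) n)
  have key := hl_mem (xv r) n r hrn I (fun k h1 h2 => by
    rw [← hsymm_eq]
    exact Ideal.subset_span ⟨k, ⟨h1, h2⟩, rfl⟩)
  rw [gs, Matrix.det_apply']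
  refine I.sum_mem fun σ _ => I.mul_mem_left _ ?_
  rw [← mul_prod_erase _ _ (mem_univ j)]
  refine I.mul_mem_right _ ?_
  rw [Matrix.of_apply]
  split_ifs
  · exact key _ (by omega) _ (by have := (σ j).2; omega)
  · exact I.zero_mem

theorem vander_sq (r : ℕ) : vander r ^ 2 = vd r ^ 2 := by
  rw [vd, Matrix.det_vandermonde, vander, prod_sigma', ← prod_pow, ← prod_pow]
  refine prod_bij' (fun p _ => ⟨p.1, p.2⟩) (fun p _ => (p.1, p.2)) ?_ ?_ ?_ ?_ ?_
  · simp
  · simp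
  · simp
  · simp
  · intro p _; ring

theorem sign_rev (r : ℕ) :
    ((Equiv.Perm.sign (Fin.revPerm : Equiv.Perm (Fin r)) : ℤ) : ℂ) = (-1) ^ (r * (r - 1) / 2) := by
  rw [Equiv.Perm.sign_eq_prod_prod_Ioi]
  have : ∀ i : Fin r, ∏ j ∈ Ioi i, (if (Fin.revPerm i) < Fin.revPerm j then (1 : ℤˣ) else -1)
      = (-1) ^ (r - 1 - i : ℕ) := by
    intro i
    rw [prod_congr rfl (g := fun _ => (-1 : ℤˣ)), prod_const, Fin.card_Ioi]
    intro j hj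
    rw [mem_Ioi] at hj
    rw [if_neg]
    simpa using hj.le
  rw [prod_congr rfl fun i _ => this i, prod_pow_eq_pow_sum,
    Fin.sum_univ_eq_sum_range (fun i => r - 1 - i), sum_range_reflect (fun i => i) r, sum_range_id]
  simp

theorem rename_vd (r : ℕ) (σ : Equiv.Perm (Fin r)) :
    rename σ (vd r) = (Equiv.Perm.sign σ : MvPolynomial (Fin r) ℂ) * vd r := by
  rw [vd, ← Matrix.det_permute, AlgHom.map_det]
  congr 1
  ext1 i j
  simp [Matrix.vandermonde]

theorem alt_monomial (r : ℕ) (a : Fin r →₀ ℕ) :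
    ∑ σ : Equiv.Perm (Fin r), (Equiv.Perm.sign σ : MvPolynomial (Fin r) ℂ) *
      rename σ (monomial a (1 : ℂ)) = alt r a := by
  rw [alt, Matrix.det_apply']
  refine sum_congr rfl fun σ _ => ?_
  congr 1
  rw [monomial_eq, Finsupp.prod_fintype _ _ (by simp)]
  simp [map_prod]

theorem main_sum (r : ℕ) (P : MvPolynomial (Fin r) ℂ) (hP : P.IsSymmetric) :
    (r.factorial : MvPolynomial (Fin r) ℂ) * P =
      ∑ a ∈ (P * vd r).support, C (coeff a (P * vd r)) * gs r a := by
  apply mul_left_cancel₀ (vd_ne_zero r)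
  have h1 : ∑ σ : Equiv.Perm (Fin r), (Equiv.Perm.sign σ : MvPolynomial (Fin r) ℂ) *
      rename σ (P * vd r) = vd r * ((r.factorial : MvPolynomial (Fin r) ℂ) * P) := by
    have : ∀ σ : Equiv.Perm (Fin r), (Equiv.Perm.sign σ : MvPolynomial (Fin r) ℂ) *
      rename σ (P * vd r) = P * vd r := by
      intro σ
      rw [map_mul, hP σ, rename_vd]
      have : ((Equiv.Perm.sign σ : ℤ) : MvPolynomial (Fin r) ℂ) * (Equiv.Perm.sign σ : ℤ) = 1 := by
        rw [← Int.cast_mul]; simp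
      linear_combination (P * vd r) * this
    rw [sum_congr rfl fun σ _ => this σ, sum_const, card_univ, Fintype.card_perm, Fintype.card_fin,
      nsmul_eq_mul]
    ring
  rw [← h1]
  conv_lhs => rw [as_sum (P * vd r)]
  simp_rw [map_sum, mul_sum]
  rw [sum_comm]
  refine sum_congr rfl fun a _ => ?_
  rw [mul_left_comm, ← alt_eq, ← alt_monomial, mul_sum]
  refine sum_congr rfl fun σ _ => ?_
  have : monomial a (coeff a (P * vd r)) = C (coeff a (P * vd r)) * monomial a 1 := by
    rw [C_mul_monomial, mul_one]
  rw [this, map_mul, rename_C]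
  ring

/-- exponent attached to a permutation -/
noncomputable def ex (r m : ℕ) (τ : Equiv.Perm (Fin r)) : Fin r →₀ ℕ :=
  Finsupp.equivFunOnFinite.symm fun j => m + (τ j : ℕ)

theorem ex_apply (r m : ℕ) (τ : Equiv.Perm (Fin r)) (j : Fin r) : ex r m τ j = m + (τ j : ℕ) := rfl

theorem ex_inj (r m : ℕ) : Function.Injective (ex r m) := by
  intro σ τ h
  ext j
  have := DFunLike.congr_fun h j
  simpa [ex_apply] using this

theorem gs_ex (r m : ℕ) (τ : Equiv.Perm (Fin r)) :
    gs r (ex r m τ) = (Equiv.Perm.sign τ : MvPolynomial (Fin r) ℂ) * (∏ i, X i) ^ m := by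
  apply mul_left_cancel₀ (vd_ne_zero r)
  rw [← alt_eq, alt]
  have : (Matrix.of fun i j : Fin r => (X i : MvPolynomial (Fin r) ℂ) ^ ex r m τ j) =
      Matrix.of fun i j => X i ^ m *
        ((Matrix.vandermonde (X : Fin r → MvPolynomial (Fin r) ℂ)).submatrix id τ) i j := by
    ext1 i j
    simp [ex_apply, pow_add, Matrix.vandermonde]
  rw [this, Matrix.det_mul_column, Matrix.det_permute', ← vd, prod_pow]
  ring

theorem vd_eq (r : ℕ) : vd r = ∑ τ : Equiv.Perm (Fin r),
    (Equiv.Perm.sign τ : MvPolynomial (Fin r) ℂ) * monomial (ex r 0 τ) 1 := by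
  rw [vd, ← Matrix.det_transpose, Matrix.det_apply']
  refine sum_congr rfl fun σ _ => ?_
  congr 1
  rw [monomial_eq, Finsupp.prod_fintype _ _ (by simp)]
  simp [Matrix.vandermonde, ex_apply]

theorem vd_hom (r : ℕ) : (vd r).IsHomogeneous (∑ i : Fin r, (i : ℕ)) := by
  rw [vd_eq]
  refine IsHomogeneous.sum _ _ _ fun τ _ => ?_
  have h : (monomial (ex r 0 τ) (((Equiv.Perm.sign τ : ℤ) : ℂ))).IsHomogeneous (∑ i : Fin r, (i : ℕ)) := by
    apply isHomogeneous_monomial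
    rw [Finsupp.degree_eq_sum]
    simp only [ex_apply, zero_add]
    exact Equiv.sum_comp τ (fun i : Fin r => (i : ℕ))
  convert h using 1
  rw [← mul_one (((Equiv.Perm.sign τ : ℤ) : ℂ)), ← C_mul_monomial]
  simp

theorem sum_lemma (r n m : ℕ) (hn : n = m + r) (a : Fin r → ℕ) (ha : Function.Injective a)
    (hlt : ∀ j, a j < n) (hs : ∑ j, a j = r * m + ∑ i : Fin r, (i : ℕ)) :
    ∀ j, m ≤ a j := by
  classical
  set S := univ.image a with hS
  set T := Finset.Ico m n with hT
  have hcS : S.card = r := by rw [card_image_of_injective _ ha]; simp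
  have hcT : T.card = r := by simp [hT, hn]
  have hsS : ∑ x ∈ S, x = r * m + ∑ i : Fin r, (i : ℕ) := by
    rw [sum_image (fun _ _ _ _ h => ha h), hs]
  have hsT : ∑ x ∈ T, x = r * m + ∑ i : Fin r, (i : ℕ) := by
    rw [hT, sum_Ico_eq_sum_range, Fin.sum_univ_eq_sum_range (fun i => i), sum_add_distrib]
    simp [hn]
  have e1 := sum_inter_add_sum_sdiff S T (fun x => x)
  have e2 := sum_inter_add_sum_sdiff T S (fun x => x)
  have c1 := card_sdiff_add_card_inter S T
  have c2 := card_sdiff_add_card_inter T S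
  rw [inter_comm] at e2 c2
  have b1 : ∑ x ∈ S \ T, (x + 1) ≤ (S \ T).card * m := by
    rw [← smul_eq_mul]
    refine sum_le_card_nsmul _ _ _ fun x hx => ?_
    rw [mem_sdiff] at hx
    obtain ⟨j, -, rfl⟩ := mem_image.1 hx.1
    have := hlt j
    have h2 := hx.2
    rw [hT, mem_Ico] at h2
    omega
  have b2 : (T \ S).card * m ≤ ∑ x ∈ T \ S, x := by
    rw [← smul_eq_mul]
    refine card_nsmul_le_sum _ _ _ fun x hx => ?_
    rw [mem_sdiff, hT, mem_Ico] at hx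
    exact hx.1.1
  have hcc : (S \ T).card = (T \ S).card := by omega
  rw [sum_add_distrib, hcc] at b1
  simp only [sum_const, smul_eq_mul, mul_one] at b1
  have h0 : (S \ T).card = 0 := by omega
  rw [card_eq_zero, sdiff_eq_empty_iff_subset] at h0
  intro j
  have := h0 (mem_image_of_mem a (mem_univ j))
  rw [hT, mem_Ico] at this
  exact this.1

theorem gs_mem' (r n m : ℕ) (hn : n = m + r) (a : Fin r →₀ ℕ)
    (hs : ∑ j, a j = r * m + ∑ i : Fin r, (i : ℕ)) (hne : ∀ τ, a ≠ ex r m τ) :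
    gs r a ∈ Ideal.span ((fun k => hsymm r k) '' Set.Icc (n - r + 1) n) := by
  by_cases h : ∃ j, n ≤ a j
  · obtain ⟨j, hj⟩ := h
    exact gs_mem n r (by omega) a j hj
  push Not at h
  by_cases hinj : Function.Injective a
  · exfalso
    have hm := sum_lemma r n m hn a hinj h hs
    let f : Fin r → Fin r := fun j => ⟨a j - m, by have := h j; have := hm j; have := j.2; omega⟩
    have hf : Function.Injective f := by
      intro i j hij
      apply hinj
      have := congrArg Fin.val hij
      have := hm i
      have := hm j
      simp only [f] at *
      omega
    apply hne (Equiv.ofBijective f (Finite.injective_iff_bijective.1 hf))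
    ext j
    have := hm j
    simp [ex_apply, f]
    omega
  · have : gs r a = 0 := by
      apply mul_left_cancel₀ (vd_ne_zero r)
      rw [← alt_eq, mul_zero, alt]
      rw [Function.not_injective_iff] at hinj
      obtain ⟨i, j, hij, hne⟩ := hinj
      exact Matrix.det_zero_of_column_eq hne fun k => by simp [hij]
    rw [this]
    exact Ideal.zero_mem _

theorem coeff_eq (r n m : ℕ) (hn : n = m + r) (Q : MvPolynomial (Fin r) ℂ) :
    coeff (Finsupp.equivFunOnFinite.symm fun _ : Fin r => n - 1) (Q * vd r) =
      (-1) ^ (r * (r - 1) / 2) *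
        ∑ τ : Equiv.Perm (Fin r), ((Equiv.Perm.sign τ : ℤ) : ℂ) * coeff (ex r m τ) Q := by
  rw [vd_eq, mul_sum, coeff_sum, ← Equiv.sum_comp (Equiv.mulLeft Fin.revPerm), mul_sum]
  refine sum_congr rfl fun τ _ => ?_
  have h1 : (Finsupp.equivFunOnFinite.symm fun _ : Fin r => n - 1) =
      ex r m τ + ex r 0 (Fin.revPerm * τ) := by
    ext j
    have := (τ j).2
    simp [ex_apply, Fin.val_rev]
    omega
  have h2 : ((Equiv.Perm.sign (Fin.revPerm * τ) : ℤ) : MvPolynomial (Fin r) ℂ) =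
      C ((-1) ^ (r * (r - 1) / 2) * ((Equiv.Perm.sign τ : ℤ) : ℂ)) := by
    rw [← sign_rev, Equiv.Perm.sign_mul]
    simp
  rw [Equiv.coe_mulLeft, h1, h2, mul_left_comm, coeff_C_mul, coeff_mul_monomial]
  ring

/-- Martin's integration formula (Theorem 2.1) in algebraic form: for a symmetric
polynomial `P`, homogeneous of degree `r(n-r)`, letting
`c₀ = ((-1)^{r(r-1)/2}/r!) · [coefficient of x₁^{n-1}⋯x_r^{n-1} in P·Δ²]`,
the polynomial `P - c₀ (x₁⋯x_r)^{n-r}` lies in the ideal `⟨h_{n-r+1}, …, h_n⟩`. -/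
theorem martin_integration (n r : ℕ) (hr : 1 ≤ r) (hrn : r ≤ n)
    (P : MvPolynomial (Fin r) ℂ) (hP : P.IsSymmetric)
    (hhom : P.IsHomogeneous (r * (n - r))) :
    P - C (((-1 : ℂ) ^ (r * (r - 1) / 2) / (r.factorial : ℂ)) *
          MvPolynomial.coeff (Finsupp.equivFunOnFinite.symm fun _ : Fin r => n - 1)
            (P * vander r ^ 2)) *
        (∏ i : Fin r, X i) ^ (n - r)
      ∈ Ideal.span ((fun k => hsymm r k) '' Set.Icc (n - r + 1) n) := by
  obtain ⟨m, hm⟩ : ∃ m, n = m + r := ⟨n - r, by omega⟩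
  have hnr : n - r = m := by omega
  set I := Ideal.span ((fun k => hsymm r k) '' Set.Icc (n - r + 1) n) with hI
  have hfac : (r.factorial : ℂ) ≠ 0 := by exact_mod_cast r.factorial_ne_zero
  have hsign : ((-1 : ℂ) ^ (r * (r - 1) / 2)) * (-1 : ℂ) ^ (r * (r - 1) / 2) = 1 := by
    rw [← mul_pow]; simp
  set c : ℂ := ∑ τ : Equiv.Perm (Fin r),
    ((Equiv.Perm.sign τ : ℤ) : ℂ) * coeff (ex r m τ) (P * vd r) with hc
  have hcoef : ((-1 : ℂ) ^ (r * (r - 1) / 2) / (r.factorial : ℂ)) *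
          MvPolynomial.coeff (Finsupp.equivFunOnFinite.symm fun _ : Fin r => n - 1)
            (P * vander r ^ 2) = (r.factorial : ℂ)⁻¹ * c := by
    rw [vander_sq, sq, ← mul_assoc, coeff_eq r n m hm, ← hc]
    linear_combination (c * (r.factorial : ℂ)⁻¹) * hsign
  rw [hcoef, hnr]
  have hmem : (r.factorial : MvPolynomial (Fin r) ℂ) * P - C c * (∏ i : Fin r, X i) ^ m ∈ I := by
    classical
    rw [main_sum r P hP]
    set Q := P * vd r with hQ
    have hT : C c * (∏ i : Fin r, X i) ^ m =
        ∑ a ∈ univ.image (ex r m), C (coeff a Q) * gs r a := by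
      rw [sum_image (fun _ _ _ _ h => ex_inj r m h), hc, map_sum, sum_mul]
      refine sum_congr rfl fun τ _ => ?_
      rw [gs_ex]
      simp
      ring
    have hS : ∑ a ∈ Q.support, C (coeff a Q) * gs r a =
        ∑ a ∈ Q.support ∪ univ.image (ex r m), C (coeff a Q) * gs r a := by
      refine sum_subset subset_union_left fun a _ ha => ?_
      rw [notMem_support_iff.1 ha]; simp
    rw [hS, hT, ← sum_sdiff (subset_union_right (s₁ := Q.support) (s₂ := univ.image (ex r m))),
      add_sub_cancel_right]
    refine I.sum_mem fun a ha => ?_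
    rw [mem_sdiff, mem_union] at ha
    obtain ⟨h1, h2⟩ := ha
    have h1 := h1.resolve_right h2
    refine I.mul_mem_left _ (gs_mem' r n m hm a ?_ ?_)
    · have hh := (hhom.mul (vd_hom r)) (mem_support_iff.1 h1)
      rw [hnr] at hh
      rw [← hh, Finsupp.weight_apply, Finsupp.sum_fintype _ _ (by simp)]
      simp
    · rintro τ rfl
      exact h2 (mem_image_of_mem _ (mem_univ τ))
  have := I.mul_mem_left (C (r.factorial : ℂ)⁻¹) hmem
  convert this using 1
  have h3 : C (r.factorial : ℂ)⁻¹ * (r.factorial : MvPolynomial (Fin r) ℂ) = 1 := by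
    rw [← C_eq_coe_nat, ← C_mul, inv_mul_cancel₀ hfac, C_1]
  rw [C_mul]
  linear_combination (-P) * h3
end
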